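/- arXiv:2403.18109 — 3 statements merged into one kernel-verified Lean document; each statement's English description precedes it below -/
import Mathlib

section
/- Let ν be a binary sequence with ν₁ = 1 and write ρ = ρ_ν. If m ∈ orb_ρ(1) (i.e. m is an entry of the internal address of ν) and s ≥ 1 satisfies s < m < ρ(s), then ρ(m−s) is finite and m ∈ orb_ρ(ρ(m−s) − (m−s)). -/
/-- `rho ν n` is the least `k > n` with `ν k ≠ ν (k - n)`, or `∞` if no such `k` exists.
Sequences are indexed by positive integers (the value at `0` is irrelevant). -/
noncomputable def rho (ν : ℕ → Bool) (n : ℕ) : ℕ∞ :=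
  sInf {k : ℕ∞ | ∃ j : ℕ, k = (j : ℕ∞) ∧ n < j ∧ ν j ≠ ν (j - n)}

/-- `inOrb ν k m` says that `m` belongs to the forward `ρ_ν`-orbit of `k`,
i.e. `m` is reached from `k` by finitely many applications of `ρ_ν`,
all of whose intermediate values are finite. -/
def inOrb (ν : ℕ → Bool) (k m : ℕ) : Prop :=
  ∃ (i : ℕ) (f : ℕ → ℕ), f 0 = k ∧ f i = m ∧ ∀ j < i, rho ν (f j) = (f (j + 1) : ℕ∞)

theorem rho_eq_coe_iff {ν : ℕ → Bool} {n r : ℕ} :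
    rho ν n = (r : ℕ∞) ↔
      (n < r ∧ ν r ≠ ν (r - n)) ∧ ∀ i, n < i → i < r → ν i = ν (i - n) := by
  constructor
  · intro h
    have hne : {k : ℕ∞ | ∃ j : ℕ, k = (j : ℕ∞) ∧ n < j ∧ ν j ≠ ν (j - n)}.Nonempty := by
      by_contra hemp
      rw [Set.not_nonempty_iff_eq_empty] at hemp
      rw [rho, hemp, sInf_empty] at h
      exact ENat.natCast_ne_top r h.symm
    have hmem := csInf_mem hne
    rw [← rho, h] at hmem
    obtain ⟨j, hj, hnj, hd⟩ := hmem
    obtain rfl : r = j := by exact_mod_cast hj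
    refine ⟨⟨hnj, hd⟩, fun i hi hir => ?_⟩
    by_contra hne'
    have hle : rho ν n ≤ (i : ℕ∞) := sInf_le ⟨i, rfl, hi, hne'⟩
    rw [h] at hle
    have : r ≤ i := by exact_mod_cast hle
    omega
  · rintro ⟨⟨hnr, hd⟩, hmin⟩
    apply le_antisymm
    · exact sInf_le ⟨r, rfl, hnr, hd⟩
    · apply le_sInf
      rintro _ ⟨j, rfl, hnj, hdj⟩
      by_contra hlt
      have hjr : j < r := by
        have := not_le.mp hlt
        exact_mod_cast this
      exact hdj (hmin j hnj hjr)

theorem rho_eq_add {ν : ℕ → Bool} {n j : ℕ} (hj : 1 ≤ j) (hd : ν (n + j) ≠ ν j)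
    (hmin : ∀ i, 1 ≤ i → i < j → ν (n + i) = ν i) : rho ν n = ((n + j : ℕ) : ℕ∞) := by
  refine rho_eq_coe_iff.2 ⟨⟨by omega, by simpa using hd⟩, fun i hi hij => ?_⟩
  have := hmin (i - n) (by omega) (by omega)
  rwa [Nat.add_sub_cancel' hi.le] at this

theorem inOrb_refl (ν : ℕ → Bool) (k : ℕ) : inOrb ν k k :=
  ⟨0, fun _ => k, rfl, rfl, by simp⟩

theorem inOrb.cons {ν : ℕ → Bool} {k l m : ℕ} (h : rho ν k = (l : ℕ∞)) (hl : inOrb ν l m) :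
    inOrb ν k m := by
  obtain ⟨i, f, h0, hi, hf⟩ := hl
  refine ⟨i + 1, fun j => Nat.casesOn j k f, rfl, hi, ?_⟩
  rintro (_ | j) hj
  · simpa [h0] using h
  · exact hf j (by omega)

/-- Induction along a `ρ`-orbit, from its end point backwards. -/
theorem inOrb.backward_induction {ν : ℕ → Bool} {m : ℕ} {P : ℕ → Prop} (base : P m)
    (step : ∀ k l : ℕ, rho ν k = (l : ℕ∞) → inOrb ν l m → P l → P k) {k : ℕ} (h : inOrb ν k m) :
    P k := by
  obtain ⟨i, f, h0, hi, hf⟩ := h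
  induction i generalizing k f with
  | zero => rw [← h0, hi]; exact base
  | succ i ih =>
    have htail : ∀ j < i, rho ν (f (j + 1)) = (f (j + 1 + 1) : ℕ∞) :=
      fun j hj => hf (j + 1) (by omega)
    refine step k (f 1) (h0 ▸ hf 0 (by omega)) ⟨i, fun j => f (j + 1), rfl, hi, htail⟩ ?_
    exact ih (fun j => f (j + 1)) rfl hi htail

theorem inOrb.le {ν : ℕ → Bool} {k m : ℕ} (h : inOrb ν k m) : k ≤ m :=
  h.backward_induction (P := fun k => k ≤ m) le_rfl
    fun _ _ hkl _ hl => (rho_eq_coe_iff.1 hkl).1.1.le.trans hl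

/-- View `0, …, m - 1` as the critical orbit of the `⋆`-periodic sequence `ν₁ … ν_{m-1} ⋆`, where
`a` is the point with itinerary `ν_{a+1} ν_{a+2} …` and `m - 1` is the critical point.
`sideOf ν m d a` is the side of the point `m - 1 - d` on which `a` lies: apply the dynamics `d`
times, and replace a point by the critical value `0` whenever the critical point separates it from
the image of `m - 1 - d`. -/
def sideOf (ν : ℕ → Bool) (m : ℕ) : ℕ → ℕ → Bool
  | 0, a => ν (a + 1)
  | d + 1, a => sideOf ν m d (if a + 1 < m ∧ ν (a + 1) = ν (m - (d + 1)) then a + 1 else 0)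

theorem sideOf_succ_of_eq {ν : ℕ → Bool} {m d a : ℕ} (ha : a + 1 < m)
    (h : ν (a + 1) = ν (m - (d + 1))) : sideOf ν m (d + 1) a = sideOf ν m d (a + 1) := by
  rw [sideOf, if_pos ⟨ha, h⟩]

theorem sideOf_succ_of_ne {ν : ℕ → Bool} {m d a : ℕ} (h : ν (a + 1) ≠ ν (m - (d + 1))) :
    sideOf ν m (d + 1) a = sideOf ν m d 0 := by
  rw [sideOf, if_neg fun h' => h h'.2]

theorem sideOf_succ_critical {ν : ℕ → Bool} {m d a : ℕ} (ha : m ≤ a + 1) :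
    sideOf ν m (d + 1) a = sideOf ν m d 0 := by
  rw [sideOf, if_neg fun h' => by omega]

theorem sideOf_add {ν : ℕ → Bool} {m d p a i : ℕ} (hp : p + i + d + 1 = m) (ha : a + i < m)
    (h : ∀ j, 1 ≤ j → j ≤ i → ν (a + j) = ν (p + j)) :
    sideOf ν m (d + i) a = sideOf ν m d (a + i) := by
  induction i generalizing d with
  | zero => rfl
  | succ i ih =>
    have hstep := ih (d := d + 1) (by omega) (by omega) fun j h1 h2 => h j h1 (by omega)
    rw [show d + (i + 1) = d + 1 + i by omega, hstep]
    refine sideOf_succ_of_eq (by omega) ?_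
    rw [show m - (d + 1) = p + (i + 1) by omega]
    exact h (i + 1) (by omega) le_rfl

/-- Of three distinct points, at most one lies between the other two. -/
theorem sideOf_nested {ν : ℕ → Bool} {m d p e q a : ℕ} (hp : p + d + 1 = m) (hq : q + e + 1 = m)
    (ha : a < m) (hap : a ≠ p) (haq : a ≠ q) (hpq : p ≠ q)
    (h : sideOf ν m d a ≠ sideOf ν m d q) : sideOf ν m e a = sideOf ν m e p := by
  induction d generalizing p e q a with
  | zero =>
    obtain _ | e := e
    · omega
    have hq' : m - (e + 1) = q + 1 := by omega
    rw [sideOf_succ_of_ne (by rw [hq']; exact h), sideOf_succ_critical (by omega)]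
  | succ d ih =>
    have hp' : m - (d + 1) = p + 1 := by omega
    obtain _ | e := e
    · by_contra hne
      exact h (by rw [sideOf_succ_of_ne (by rw [hp']; exact hne), sideOf_succ_critical (by omega)])
    have hq' : m - (e + 1) = q + 1 := by omega
    by_cases hs : ν (q + 1) = ν (p + 1)
    · rw [sideOf_succ_of_eq (a := q) (by omega) (by rw [hp', hs])] at h
      rw [sideOf_succ_of_eq (a := p) (by omega) (by rw [hq', hs])]
      by_cases hsa : a + 1 < m ∧ ν (a + 1) = ν (p + 1)
      · rw [sideOf_succ_of_eq hsa.1 (by rw [hp', hsa.2])] at h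
        rw [sideOf_succ_of_eq hsa.1 (by rw [hq', hsa.2, hs])]
        exact ih (by omega) (by omega) hsa.1 (by omega) (by omega) (by omega) h
      · rw [sideOf, hp', if_neg hsa] at h
        rw [sideOf, hq', hs, if_neg hsa]
        exact ih (by omega) (by omega) (by omega) (by omega) (by omega) (by omega) h
    · rw [sideOf_succ_of_ne (a := q) (by rwa [hp'])] at h
      rw [sideOf_succ_of_ne (a := p) (by rw [hq']; exact Ne.symm hs)]
      by_cases hsa : a + 1 < m ∧ ν (a + 1) = ν (p + 1)
      · exact sideOf_succ_of_ne (by rw [hq', hsa.2]; exact Ne.symm hs)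
      · rw [sideOf, hp', if_neg hsa] at h
        exact absurd rfl h

/-- Some point of the critical orbit is an endpoint. -/
theorem exists_sideOf_const (ν : ℕ → Bool) {m : ℕ} (hm : 2 ≤ m) :
    ∃ d p, p + d + 1 = m ∧ ∃ c, ∀ a < m, a ≠ p → sideOf ν m d a = c := by
  by_contra! hcon
  have key : ∀ N d p c, p + d + 1 = m →
      ((Finset.range m).filter fun a => a ≠ p ∧ sideOf ν m d a = c).card = N →
      ∀ q < m, q ≠ p → sideOf ν m d q = c → False := by
    intro N
    induction N using Nat.strong_induction_on with
    | _ N ih =>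
      intro d p c hp hN q hqm hqp hqc
      have hq : q + (m - 1 - q) + 1 = m := by omega
      obtain ⟨a, ham, haq, hac⟩ := hcon _ q hq (sideOf ν m (m - 1 - q) p)
      refine ih _ ?_ _ q _ hq rfl a ham haq rfl
      rw [← hN]
      refine Finset.card_lt_card ((Finset.ssubset_iff_of_subset ?_).2 ⟨q, ?_, ?_⟩)
      · intro b hb
        simp only [Finset.mem_filter, Finset.mem_range] at hb ⊢
        obtain ⟨hbm, hbq, hbs⟩ := hb
        have hbp : sideOf ν m (m - 1 - q) b ≠ sideOf ν m (m - 1 - q) p := by rwa [hbs]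
        have hne : b ≠ p := by rintro rfl; exact hbp rfl
        exact ⟨hbm, hne, by rw [sideOf_nested hq hp hbm hbq hne hqp hbp, hqc]⟩
      · simp [hqm, hqp, hqc]
      · simp
  exact key _ (m - 1) 0 _ (by omega) rfl 1 (by omega) (by omega) rfl

/-- The critical value `0` is an endpoint. -/
theorem sideOf_critical_value_const (ν : ℕ → Bool) {m a b : ℕ} (ha : 1 ≤ a) (ham : a < m)
    (hb : 1 ≤ b) (hbm : b < m) : sideOf ν m (m - 1) a = sideOf ν m (m - 1) b := by
  obtain ⟨d, p, hp, c, hc⟩ := exists_sideOf_const ν (m := m) (by omega)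
  induction p generalizing d with
  | zero =>
    obtain rfl : d = m - 1 := by omega
    rw [hc a ham (by omega), hc b hbm (by omega)]
  | succ p ih =>
    refine ih (d + 1) (by omega) fun x hx hxp => ?_
    rw [sideOf]
    split_ifs
    · exact hc _ (by omega) (by omega)
    · exact hc _ (by omega) (by omega)

theorem sideOf_of_first_ne {ν : ℕ → Bool} {m d p a j : ℕ} (hj : 1 ≤ j) (hp : p + j + d + 1 = m)
    (ha : a + j ≤ m) (hd : a + j = m ∨ ν (a + j) ≠ ν (p + j))
    (h : ∀ i, 1 ≤ i → i < j → ν (a + i) = ν (p + i)) :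
    sideOf ν m (d + j) a = sideOf ν m d 0 := by
  obtain ⟨i, rfl⟩ := Nat.exists_eq_add_of_le' hj
  rw [show d + (i + 1) = d + 1 + i by omega,
    sideOf_add (p := p) (by omega) (by omega) fun l h1 h2 => h l h1 (by omega)]
  rcases hd with hd | hd
  · exact sideOf_succ_critical (by omega)
  · refine sideOf_succ_of_ne ?_
    rwa [show m - (d + 1) = p + (i + 1) by omega]

/-- Whether the `ρ`-orbit of `k` hits `m` is read off from the side of the point `k` on which the
critical value lies. -/
theorem inOrb_of_sideOf_ne {ν : ℕ → Bool} {m k d : ℕ} (hk : k + d + 1 = m)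
    (h : sideOf ν m d 0 ≠ ν m) : inOrb ν k m := by
  induction d using Nat.strong_induction_on generalizing k with
  | _ d ih =>
    by_cases hex : ∃ j, 1 ≤ j ∧ j ≤ d ∧ ν (k + j) ≠ ν j
    · classical
      obtain ⟨hj, hjd, hne⟩ := Nat.find_spec hex
      set j := Nat.find hex
      have hmin : ∀ i, 1 ≤ i → i < j → ν (k + i) = ν i := by
        intro i h1 hi
        by_contra hni
        exact Nat.find_min hex hi ⟨h1, by omega, hni⟩
      refine .cons (rho_eq_add hj hne hmin) (ih (d - j) (by omega) (by omega) ?_)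
      rwa [← sideOf_of_first_ne (p := k) (a := 0) hj (by omega) (by omega)
        (Or.inr (by simpa using hne.symm)) (fun i h1 hi => by simpa using (hmin i h1 hi).symm),
        Nat.sub_add_cancel hjd]
    · push Not at hex
      have hrun := sideOf_add (ν := ν) (m := m) (d := 0) (p := k) (a := 0) (i := d) (by omega)
        (by omega) fun j h1 h2 => by simpa using (hex j h1 h2).symm
      rw [Nat.zero_add, sideOf] at hrun
      have hr : rho ν k = ((k + (d + 1) : ℕ) : ℕ∞) := by
        refine rho_eq_add (by omega) ?_ fun i h1 hi => hex i h1 (by omega)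
        rw [← hrun, ← Nat.add_assoc, hk]
        exact h.symm
      refine .cons hr ?_
      rw [← Nat.add_assoc, hk]
      exact inOrb_refl ν m

theorem sideOf_ne_of_inOrb {ν : ℕ → Bool} {m k : ℕ} (h : inOrb ν k m) :
    ∀ d, k + d + 1 = m → sideOf ν m d 0 ≠ ν m := by
  refine h.backward_induction (P := fun k => ∀ d, k + d + 1 = m → sideOf ν m d 0 ≠ ν m)
    (fun d hd => by omega) fun k l hkl hl ih d hd => ?_
  obtain ⟨⟨hlt, hne⟩, hmin⟩ := rho_eq_coe_iff.1 hkl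
  have hlm := hl.le
  obtain ⟨j, rfl⟩ := Nat.exists_eq_add_of_lt hlt
  have hmin' : ∀ i, 1 ≤ i → i < j + 1 → ν (0 + i) = ν (k + i) := fun i h1 hi => by
    simpa using (hmin (k + i) (by omega) (by omega)).symm
  rw [show k + j + 1 - k = j + 1 by omega] at hne
  rcases hlm.eq_or_lt with hlm | hlm
  · obtain rfl : j = d := by omega
    have hrun := sideOf_add (ν := ν) (m := m) (d := 0) (p := k) (a := 0) (i := j) (by omega)
      (by omega) fun i h1 h2 => hmin' i h1 (by omega)
    rw [Nat.zero_add, sideOf] at hrun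
    rw [hrun, ← hlm]
    exact hne.symm
  · have hrun := sideOf_of_first_ne (ν := ν) (m := m) (d := d - (j + 1)) (p := k) (a := 0)
      (j := j + 1) (by omega) (by omega) (by omega)
      (Or.inr (by simpa [Nat.add_assoc] using hne.symm)) hmin'
    rw [Nat.sub_add_cancel (by omega)] at hrun
    rw [hrun]
    exact ih _ (by omega)

/-- If `m` is in the internal address of `ν` (the `ρ`-orbit of `1`) and `s < m < ρ(s)`,
then `ρ(m−s)` is finite and `m ∈ orb_ρ(ρ(m−s) − (m−s))`. -/
theorem rho_orbit_combinatorics (ν : ℕ → Bool) (hν : ν 1 = true) (m s : ℕ)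
    (hm : inOrb ν 1 m) (hs : 1 ≤ s) (hsm : s < m) (hmr : (m : ℕ∞) < rho ν s) :
    ∃ r : ℕ, rho ν (m - s) = (r : ℕ∞) ∧ inOrb ν (r - (m - s)) m := by
  obtain ⟨n, rfl⟩ := Nat.exists_eq_add_of_lt hsm
  rw [show s + n + 1 - s = n + 1 by omega]
  set m := s + n + 1
  have hside : sideOf ν m (m - 1) (n + 1) ≠ ν m := by
    rw [sideOf_critical_value_const ν (b := m - 1) (by omega) (by omega) (by omega) (by omega),
      show m - 1 = m - 2 + 1 by omega, sideOf_succ_critical (by omega)]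
    exact sideOf_ne_of_inOrb hm _ (by omega)
  by_cases hex : ∃ j, 1 ≤ j ∧ j < s ∧ ν (n + 1 + j) ≠ ν j
  · classical
    obtain ⟨hj, hjs, hne⟩ := Nat.find_spec hex
    set j := Nat.find hex
    have hmin : ∀ i, 1 ≤ i → i < j → ν (n + 1 + i) = ν i := by
      intro i h1 hi
      by_contra hni
      exact Nat.find_min hex hi ⟨h1, by omega, hni⟩
    refine ⟨n + 1 + j, rho_eq_add hj hne hmin, ?_⟩
    rw [Nat.add_sub_cancel_left]
    refine inOrb_of_sideOf_ne (d := m - 1 - j) (by omega) ?_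
    rwa [← sideOf_of_first_ne (p := 0) (a := n + 1) hj (by omega) (by omega)
      (Or.inr (by simpa using hne)) (fun i h1 hi => by simpa using hmin i h1 hi),
      Nat.sub_add_cancel (by omega)]
  · push Not at hex
    exfalso
    have horb : inOrb ν s m := by
      refine inOrb_of_sideOf_ne (d := n) rfl ?_
      rwa [← sideOf_of_first_ne (p := 0) (a := n + 1) (j := s) hs (by omega) (by omega)
        (Or.inl (by omega)) (fun i h1 hi => by simpa using hex i h1 hi),
        show n + s = m - 1 by omega]
    refine horb.backward_induction (P := fun k => k < m → (m : ℕ∞) < rho ν k → False)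
      (fun h => absurd h (lt_irrefl m)) (fun k l hkl hl _ _ hlt => ?_) hsm hmr
    rw [hkl] at hlt
    exact absurd hl.le (not_le.2 (by exact_mod_cast hlt))
end

section
/- Let χ and χ' be two distinct binary sequences, both with first entry equal to 1, and let k := diff(χ, χ') < ∞ be the position of their first difference. Then k belongs to the internal address of χ or to the internal address of χ', i.e. k ∈ orb_{ρ_χ}(1) ∪ orb_{ρ_{χ'}}(1). -/
/-- `diffB a b` is the position of the first difference of the binary sequences `a`, `b`
(positions start at `1`), or `∞` if they agree at all positions `≥ 1`. -/
noncomputable def diffB (a b : ℕ → Bool) : ℕ∞ :=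
  sInf {k : ℕ∞ | ∃ n : ℕ, k = (n : ℕ∞) ∧ 1 ≤ n ∧ a n ≠ b n}

theorem rho_eq_coe {ν : ℕ → Bool} {m j : ℕ} (hmj : m < j) (hne : ν j ≠ ν (j - m))
    (hlt : ∀ i, m < i → i < j → ν i = ν (i - m)) : rho ν m = (j : ℕ∞) := by
  refine le_antisymm (sInf_le ⟨j, rfl, hmj, hne⟩) (le_sInf ?_)
  rintro _ ⟨i, rfl, hmi, hi⟩
  by_contra hij
  exact hi (hlt i hmi (by exact_mod_cast not_le.mp hij))

theorem inOrb.step {ν : ℕ → Bool} {k m n : ℕ} (h : inOrb ν k m) (hn : rho ν m = (n : ℕ∞)) :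
    inOrb ν k n := by
  obtain ⟨i, f, h0, hi, hf⟩ := h
  refine ⟨i + 1, fun j => if j ≤ i then f j else n, by simpa using h0, by simp, fun j hj => ?_⟩
  rcases Nat.lt_succ_iff_lt_or_eq.mp hj with hj | rfl
  · simpa [hj.le, Nat.succ_le_of_lt hj] using hf j hj
  · simpa [hi] using hn

theorem diffB_eq_coe {a b : ℕ → Bool} {k : ℕ} (hk : diffB a b = (k : ℕ∞)) :
    1 ≤ k ∧ a k ≠ b k ∧ ∀ n, 1 ≤ n → n < k → a n = b n := by
  have hne : {k : ℕ∞ | ∃ n : ℕ, k = (n : ℕ∞) ∧ 1 ≤ n ∧ a n ≠ b n}.Nonempty := by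
    by_contra h
    rw [diffB, Set.not_nonempty_iff_eq_empty.mp h, sInf_empty] at hk
    exact ENat.top_ne_natCast k hk
  obtain ⟨n, hn, h1n, hab⟩ := csInf_mem hne
  obtain rfl : k = n := by exact_mod_cast hk.symm.trans hn
  refine ⟨h1n, hab, fun i h1i hik => ?_⟩
  by_contra hi
  have hle : diffB a b ≤ (i : ℕ∞) := sInf_le ⟨i, rfl, h1i, hi⟩
  rw [hk, Nat.cast_le] at hle
  omega

/-- If `m < k` lies in the orbits of `l` for both sequences and `k` is their first difference,
then following the common part of the orbits beyond `m` leads to `k` for one of them. -/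
theorem inOrb_or_inOrb_of_common {χ χ' : ℕ → Bool} {k l : ℕ} (hne : χ k ≠ χ' k)
    (heq : ∀ n, 1 ≤ n → n < k → χ n = χ' n) (m : ℕ) (h1m : 1 ≤ m) (hmk : m < k)
    (h : inOrb χ l m) (h' : inOrb χ' l m) : inOrb χ l k ∨ inOrb χ' l k := by
  by_cases hex : ∃ j, m < j ∧ j < k ∧ χ j ≠ χ (j - m)
  · classical
    obtain ⟨hmj, hjk, hj⟩ := Nat.find_spec hex
    have hmin : ∀ i, m < i → i < Nat.find hex → χ i = χ (i - m) := fun i hmi hi => by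
      by_contra hc
      exact Nat.find_min hex hi ⟨hmi, hi.trans hjk, hc⟩
    refine inOrb_or_inOrb_of_common hne heq (Nat.find hex) (by omega) hjk
      (h.step (rho_eq_coe hmj hj hmin)) (h'.step (rho_eq_coe hmj ?_ fun i hmi hi => ?_))
    · rwa [← heq _ (by omega) hjk, ← heq _ (by omega) (by omega)]
    · rw [← heq i (by omega) (by omega), ← heq (i - m) (by omega) (by omega)]
      exact hmin i hmi hi
  · push Not at hex
    by_cases hk : χ k = χ (k - m)
    · refine Or.inr (h'.step (rho_eq_coe hmk ?_ fun i hmi hi => ?_))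
      · rw [← heq (k - m) (by omega) (by omega), ← hk]
        exact hne.symm
      · rw [← heq i (by omega) hi, ← heq (i - m) (by omega) (by omega)]
        exact hex i hmi hi
    · exact Or.inl (h.step (rho_eq_coe hmk hk hex))
termination_by k - m

/-- If `χ ≠ χ'` are binary sequences starting with `1` and `k` is the (finite) position of
their first difference, then `k` belongs to the internal address of `χ` or of `χ'`. -/
theorem first_difference_mem_internal_address (χ χ' : ℕ → Bool)
    (h1 : χ 1 = true) (h1' : χ' 1 = true) (k : ℕ) (hk : diffB χ χ' = (k : ℕ∞)) :
    inOrb χ 1 k ∨ inOrb χ' 1 k := by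
  obtain ⟨h1k, hne, heq⟩ := diffB_eq_coe hk
  have hk1 : 1 < k := lt_of_le_of_ne h1k (by rintro rfl; exact hne (h1.trans h1'.symm))
  exact inOrb_or_inOrb_of_common hne heq 1 le_rfl hk1 (inOrb_refl χ 1) (inOrb_refl χ' 1)
end

section
/- Let θ ∈ ℝ/ℤ be an angle that is not periodic under the doubling map. Then for every k ≥ 1 there exists δ > 0 such that every angle φ ∈ ℝ/ℤ with 0 < dist(φ, θ) < δ satisfies diff(ν(θ), ν(φ)) > k. In other words, the first k entries of the kneading sequence are locally constant at every non-periodic angle, so that diff(ν(θ), ν(φ)) → ∞ as φ → θ. -/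
noncomputable instance : Fact ((0:ℝ) < 1) := ⟨one_pos⟩

/-- The representative in `[0,1)` of a point of the circle `ℝ/ℤ`. -/
noncomputable def rep (x : AddCircle (1 : ℝ)) : ℝ :=
  (AddCircle.equivIco 1 0 x : ℝ)

open Classical in
/-- The kneading sequence of the angle `θ`: with `t ∈ [0,1)` the representative of `θ`,
the `k`-th entry records whether `2^(k-1) θ` lies in the open arc `A₁ = (t/2, (t+1)/2)`
containing `θ`, in the complementary open arc `A₀`, or is one of the two boundary points
`θ/2, (θ+1)/2` (the symbol `⋆`, encoded as `none`). Positions start at `1`. -/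
noncomputable def nu (θ : AddCircle (1 : ℝ)) (k : ℕ) : Option Bool :=
  let t := rep θ
  let x := rep ((2 ^ (k - 1) : ℕ) • θ)
  if x = t / 2 ∨ x = (t + 1) / 2 then none
  else if t / 2 < x ∧ x < (t + 1) / 2 then some true
  else some false

/-- Position of the first genuinely different entry (positions `≥ 1`), with `⋆ = none`
acting as a wildcard; `∞` if there is none. -/
noncomputable def diffW (a b : ℕ → Option Bool) : ℕ∞ :=
  sInf {k : ℕ∞ | ∃ n : ℕ, k = (n : ℕ∞) ∧ 1 ≤ n ∧
    ∃ x y : Bool, a n = some x ∧ b n = some y ∧ x ≠ y}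


/-- `θ` is periodic under the angle-doubling map. -/
def DoublingPeriodic (θ : AddCircle (1 : ℝ)) : Prop :=
  ∃ n, 1 ≤ n ∧ (2 ^ n : ℕ) • θ = θ

open Filter Topology

lemma coe_rep (x : AddCircle (1 : ℝ)) : ((rep x : ℝ) : AddCircle (1 : ℝ)) = x :=
  AddCircle.coe_equivIco

lemma rep_mem (x : AddCircle (1 : ℝ)) : 0 ≤ rep x ∧ rep x < 1 := by
  simpa [rep] using (AddCircle.equivIco 1 0 x).2

lemma continuousAt_rep {x : AddCircle (1 : ℝ)} (hx : x ≠ 0) : ContinuousAt rep x :=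
  continuous_subtype_val.continuousAt.comp
    (AddCircle.continuousAt_equivIco (p := 1) (a := 0) (by simpa using hx))

lemma rep_pos {x : AddCircle (1 : ℝ)} (hx : x ≠ 0) : 0 < rep x := by
  refine (rep_mem x).1.lt_of_ne fun h => hx ?_
  rw [← coe_rep x, ← h, AddCircle.coe_zero]

lemma rep_zero : rep 0 = 0 := by
  have h := AddCircle.equivIco_coe_of_mem (p := (1 : ℝ)) (a := 0) (y := 0) (by simp)
  rwa [AddCircle.coe_zero] at h

/-- Near the origin of the circle, representatives in `[0,1)` are close to `0` or to `1`. -/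
lemma eventually_rep_lt_or_gt {a b : ℝ} (ha : 0 < a) (hb : b < 1) :
    ∀ᶠ x in 𝓝 (0 : AddCircle (1 : ℝ)), rep x < a ∨ b < rep x := by
  have hclosed : IsClosed ((fun r : ℝ => (r : AddCircle (1 : ℝ))) '' Set.Icc a b) :=
    (isCompact_Icc.image (AddCircle.continuous_mk' 1)).isClosed
  have hzero : (0 : AddCircle (1 : ℝ)) ∈
      ((fun r : ℝ => (r : AddCircle (1 : ℝ))) '' Set.Icc a b)ᶜ := by
    rintro ⟨r, ⟨har, hrb⟩, hr⟩
    obtain ⟨n, hn⟩ := (AddCircle.coe_eq_zero_iff 1).1 hr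
    simp only [zsmul_eq_mul, mul_one] at hn
    have h0 : (0 : ℝ) < n := by linarith
    have h1 : (n : ℝ) < 1 := by linarith
    norm_cast at h0 h1
    lia
  filter_upwards [hclosed.isOpen_compl.mem_nhds hzero] with x hx
  by_contra! h
  exact hx ⟨rep x, h, coe_rep x⟩

lemma nu_eq_some_true {θ : AddCircle (1 : ℝ)} {n : ℕ}
    (h₁ : rep θ / 2 < rep ((2 ^ (n - 1) : ℕ) • θ))
    (h₂ : rep ((2 ^ (n - 1) : ℕ) • θ) < (rep θ + 1) / 2) : nu θ n = some true := by
  simp only [nu]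
  rw [if_neg (not_or.2 ⟨h₁.ne', h₂.ne⟩), if_pos ⟨h₁, h₂⟩]

lemma nu_eq_some_false {θ : AddCircle (1 : ℝ)} {n : ℕ}
    (h : rep ((2 ^ (n - 1) : ℕ) • θ) < rep θ / 2 ∨
      (rep θ + 1) / 2 < rep ((2 ^ (n - 1) : ℕ) • θ)) : nu θ n = some false := by
  simp only [nu]
  rw [if_neg, if_neg]
  · rintro ⟨h₁, h₂⟩
    rcases h with h | h <;> linarith
  · rintro (h' | h') <;> rcases h with h | h <;> linarith

lemma two_nsmul_eq_of_rep_eq {x θ : AddCircle (1 : ℝ)}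
    (h : rep x = rep θ / 2 ∨ rep x = (rep θ + 1) / 2) : 2 • x = θ := by
  rw [← coe_rep x, ← coe_rep θ, ← AddCircle.coe_nsmul]
  rcases h with h | h <;> rw [h, nsmul_eq_mul]
  · congr 1
    push_cast
    ring
  · rw [← AddCircle.coe_add_period 1 (rep θ)]
    congr 1
    push_cast
    ring

/-- Each entry of the kneading sequence is locally constant at a non-periodic angle. -/
lemma eventually_nu_eq {θ : AddCircle (1 : ℝ)} (hnp : ¬ DoublingPeriodic θ) {n : ℕ}
    (hn : 1 ≤ n) : ∀ᶠ φ in 𝓝 θ, nu φ n = nu θ n := by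
  have hθ : θ ≠ 0 := by
    rintro rfl
    exact hnp ⟨1, le_rfl, smul_zero _⟩
  have ht : Tendsto rep (𝓝 θ) (𝓝 (rep θ)) := continuousAt_rep hθ
  have hlo : Tendsto (fun φ => rep φ / 2) (𝓝 θ) (𝓝 (rep θ / 2)) := ht.div_const 2
  have hhi : Tendsto (fun φ => (rep φ + 1) / 2) (𝓝 θ) (𝓝 ((rep θ + 1) / 2)) :=
    (ht.add_const 1).div_const 2
  have hy : Tendsto (fun φ : AddCircle (1 : ℝ) => (2 ^ (n - 1) : ℕ) • φ) (𝓝 θ)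
      (𝓝 ((2 ^ (n - 1) : ℕ) • θ)) := (continuous_nsmul _).tendsto θ
  have hpos := rep_pos hθ
  have hlt := (rep_mem θ).2
  by_cases hy0 : (2 ^ (n - 1) : ℕ) • θ = 0
  · have hν : nu θ n = some false :=
      nu_eq_some_false (Or.inl (by rw [hy0, rep_zero]; linarith))
    rw [hy0] at hy
    filter_upwards [hy.eventually (eventually_rep_lt_or_gt (a := rep θ / 4)
      (b := (rep θ + 3) / 4) (by linarith) (by linarith)),
      hlo.eventually_const_lt (show rep θ / 4 < rep θ / 2 by linarith),
      hhi.eventually_lt_const (show (rep θ + 1) / 2 < (rep θ + 3) / 4 by linarith)]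
      with φ h h₁ h₂
    rw [hν]
    exact nu_eq_some_false (h.imp h₁.gt.trans' h₂.trans)
  · have hx := (continuousAt_rep hy0).tendsto.comp hy
    have hne : ¬(rep ((2 ^ (n - 1) : ℕ) • θ) = rep θ / 2 ∨
        rep ((2 ^ (n - 1) : ℕ) • θ) = (rep θ + 1) / 2) := fun h => by
      refine hnp ⟨n, hn, ?_⟩
      obtain ⟨m, rfl⟩ := Nat.exists_eq_add_of_le' hn
      rw [pow_succ', mul_smul]
      exact two_nsmul_eq_of_rep_eq h
    obtain ⟨hne₁, hne₂⟩ := not_or.1 hne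
    rcases lt_or_gt_of_ne hne₁ with h₁ | h₁
    · filter_upwards [hx.eventually_lt hlo h₁] with φ hφ
      rw [nu_eq_some_false (Or.inl h₁)]
      exact nu_eq_some_false (Or.inl hφ)
    rcases lt_or_gt_of_ne hne₂ with h₂ | h₂
    · filter_upwards [hlo.eventually_lt hx h₁, hx.eventually_lt hhi h₂] with φ hφ₁ hφ₂
      rw [nu_eq_some_true h₁ h₂]
      exact nu_eq_some_true hφ₁ hφ₂
    · filter_upwards [hhi.eventually_lt hx h₂] with φ hφ
      rw [nu_eq_some_false (Or.inr h₂)]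
      exact nu_eq_some_false (Or.inr hφ)

lemma lt_diffW {a b : ℕ → Option Bool} {k : ℕ} (h : ∀ n, 1 ≤ n → n ≤ k → a n = b n) :
    (k : ℕ∞) < diffW a b := by
  refine lt_of_lt_of_le (b := ((k + 1 : ℕ) : ℕ∞)) (by exact_mod_cast k.lt_succ_self)
    (le_sInf ?_)
  rintro _ ⟨n, rfl, hn, x, y, hx, hy, hxy⟩
  by_contra! hk
  have hnk : n < k + 1 := by exact_mod_cast hk
  refine hxy (Option.some_injective _ ?_)
  rw [← hx, ← hy, h n hn (by lia)]

/-- At every angle `θ` that is non-periodic for doubling, the initial entries of the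
kneading sequence are locally constant: for every `k ≥ 1` there is `δ > 0` such that
all angles `φ` with `0 < dist(φ,θ) < δ` satisfy `diff(ν(θ), ν(φ)) > k`. -/
theorem kneading_locally_constant (θ : AddCircle (1 : ℝ))
    (hnp : ¬ DoublingPeriodic θ) :
    ∀ k : ℕ, 1 ≤ k → ∃ δ : ℝ, 0 < δ ∧ ∀ φ : AddCircle (1 : ℝ),
      0 < dist φ θ → dist φ θ < δ → (k : ℕ∞) < diffW (nu θ) (nu φ) := by
  intro k _
  have hnear : ∀ᶠ φ in 𝓝 θ, ∀ n ∈ Finset.Icc 1 k, nu φ n = nu θ n :=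
    (Filter.eventually_all_finset _).2 fun n hn =>
      eventually_nu_eq hnp (Finset.mem_Icc.1 hn).1
  obtain ⟨δ, hδ, hball⟩ := Metric.eventually_nhds_iff.1 hnear
  refine ⟨δ, hδ, fun φ _ hφ => lt_diffW fun n hn hnk => ?_⟩
  exact (hball hφ n (Finset.mem_Icc.2 ⟨hn, hnk⟩)).symm
end
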